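/- Any finite set of points in the plane can be $k$-colored so that every closed half-plane containing at least $2k-1$ of the points contains points of all $k$ colors; moreover this is tight: there is a finite planar point set such that for every $k$-coloring there is a closed half-plane containing exactly $2k-2$ points of the set that misses some color. -/

import Mathlib

/-- The affine functional whose nonnegativity set is the closed half-plane `t ≤ ⟨u, p⟩`. -/
def slack (u : ℝ × ℝ) (t : ℝ) (p : ℝ × ℝ) : ℝ := u.1 * p.1 + u.2 * p.2 - t

/-- The points of `P` lying in the closed half-plane `t ≤ ⟨u, p⟩`. -/
noncomputable def halfPlaneTrace (P : Finset (ℝ × ℝ)) (u : ℝ × ℝ) (t : ℝ) : Finset (ℝ × ℝ) :=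
  P.filter fun p => 0 ≤ slack u t p

/-- `p` lies in the open region beyond the edge `bc` of the triangle `abc`, away from the
two vertices of that edge. -/
def BeyondEdge (a b c p : ℝ × ℝ) : Prop :=
  ∃ x y z : ℝ, 0 < x ∧ 0 < y ∧ 0 < z ∧ y + z - x = 1 ∧ p = y • b + z • c - x • a

theorem mem_halfPlaneTrace {P : Finset (ℝ × ℝ)} {u : ℝ × ℝ} {t : ℝ} {p : ℝ × ℝ} :
    p ∈ halfPlaneTrace P u t ↔ p ∈ P ∧ 0 ≤ slack u t p := by
  simp [halfPlaneTrace]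

theorem slack_combination (u : ℝ × ℝ) (t : ℝ) (a b c : ℝ × ℝ) {x y z : ℝ} (h : x + y + z = 1) :
    slack u t (x • a + y • b + z • c) = x * slack u t a + y * slack u t b + z * slack u t c := by
  simp only [slack, Prod.fst_add, Prod.snd_add, Prod.smul_fst, Prod.smul_snd, smul_eq_mul]
  linear_combination t * h

theorem BeyondEdge.swap {a b c p : ℝ × ℝ} (h : BeyondEdge a b c p) : BeyondEdge a c b p := by
  obtain ⟨x, y, z, hx, hy, hz, h, rfl⟩ := h
  exact ⟨x, z, y, hx, hz, hy, by linarith, by abel⟩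

theorem convex_neg_slack (u : ℝ × ℝ) (t : ℝ) : Convex ℝ {p | slack u t p < 0} := by
  intro a ha b hb x y hx hy hxy
  have := slack_combination u t a b b (x := x) (y := y) (z := 0) (by linarith)
  simp only [zero_smul, add_zero, zero_mul, Set.mem_ofPred_eq] at this ha hb ⊢
  rw [this]
  rcases hx.eq_or_lt with rfl | hx
  · have : y = 1 := by linarith
    subst this
    linarith
  · nlinarith [mul_pos hx (neg_pos.2 ha), mul_nonneg hy (neg_pos.2 hb).le]

/-- Every point of the plane is an affine combination of three points each of which can be cut
off from the other two by a closed half-plane. -/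
theorem exists_affine_combination {a b c ua ub uc : ℝ × ℝ} {ta tb tc : ℝ}
    (haa : 0 ≤ slack ua ta a) (hab : slack ua ta b < 0) (hac : slack ua ta c < 0)
    (hba : slack ub tb a < 0) (hbb : 0 ≤ slack ub tb b) (hbc : slack ub tb c < 0)
    (hca : slack uc tc a < 0) (hcb : slack uc tc b < 0) (hcc : 0 ≤ slack uc tc c)
    (p : ℝ × ℝ) : ∃ x y z : ℝ, x + y + z = 1 ∧ p = x • a + y • b + z • c := by
  have hncol : ¬ Collinear ℝ {a, b, c} := by
    intro h
    rcases h.wbtw_or_wbtw_or_wbtw with h | h | h <;> rw [← mem_segment_iff_wbtw] at h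
    · exact hbb.not_gt ((convex_neg_slack ub tb).segment_subset hba hbc h)
    · exact hcc.not_gt ((convex_neg_slack uc tc).segment_subset hcb hca h)
    · exact haa.not_gt ((convex_neg_slack ua ta).segment_subset hac hab h)
  have hdet : (b.1 - a.1) * (c.2 - a.2) - (c.1 - a.1) * (b.2 - a.2) ≠ 0 := by
    intro h0
    apply hncol
    rw [collinear_iff_of_mem (p₀ := a) (by simp)]
    by_cases hb : b = a
    · refine ⟨c - a, ?_⟩
      simp only [Set.mem_insert_iff, Set.mem_singleton_iff, forall_eq_or_imp, forall_eq]
      exact ⟨⟨0, by simp⟩, ⟨0, by simp [hb]⟩, ⟨1, by simp⟩⟩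
    · refine ⟨b - a, ?_⟩
      simp only [Set.mem_insert_iff, Set.mem_singleton_iff, forall_eq_or_imp, forall_eq]
      refine ⟨⟨0, by simp⟩, ⟨1, by simp⟩, ?_⟩
      by_cases h1 : b.1 - a.1 = 0
      · have h2 : b.2 - a.2 ≠ 0 := fun h2 =>
          hb (Prod.ext (sub_eq_zero.1 h1) (sub_eq_zero.1 h2))
        refine ⟨(c.2 - a.2) / (b.2 - a.2), Prod.ext ?_ ?_⟩
        · have : c.1 - a.1 = 0 := by
            rw [h1] at h0
            rcases mul_eq_zero.1 (by linarith : (c.1 - a.1) * (b.2 - a.2) = 0) with h | h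
            · exact h
            · exact absurd h h2
          simp [h1]
          linarith
        · simp
          field_simp
          ring
      · refine ⟨(c.1 - a.1) / (b.1 - a.1), Prod.ext ?_ ?_⟩
        · simp
          field_simp
          ring
        · simp
          field_simp
          linarith
  set D := (b.1 - a.1) * (c.2 - a.2) - (c.1 - a.1) * (b.2 - a.2) with hD
  refine ⟨1 - ((p.1 - a.1) * (c.2 - a.2) - (c.1 - a.1) * (p.2 - a.2)) / D
      - ((b.1 - a.1) * (p.2 - a.2) - (p.1 - a.1) * (b.2 - a.2)) / D,
    ((p.1 - a.1) * (c.2 - a.2) - (c.1 - a.1) * (p.2 - a.2)) / D,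
    ((b.1 - a.1) * (p.2 - a.2) - (p.1 - a.1) * (b.2 - a.2)) / D, by ring, Prod.ext ?_ ?_⟩
  all_goals
    simp only [Prod.fst_add, Prod.snd_add, Prod.smul_fst, Prod.smul_snd, smul_eq_mul]
    field_simp
    rw [hD]
    ring

/-- An extreme point is not a nontrivial convex combination of three other points of the set. -/
theorem ne_combination_of_mem_extremePoints {A : Set (ℝ × ℝ)} (hA : Convex ℝ A)
    {a p q r : ℝ × ℝ} (ha : a ∈ A.extremePoints ℝ)
    (hp : p ∈ A) (hq : q ∈ A) (hr : r ∈ A) (hpa : p ≠ a) (hqa : q ≠ a) (hra : r ≠ a)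
    {s x y z : ℝ} (hx : 0 ≤ x) (hy : 0 ≤ y) (hz : 0 ≤ z) (hs : 0 < s) (hsum : x + y + z = s) :
    s • a ≠ x • p + y • q + z • r := by
  intro h
  have hconv := (hA.mem_extremePoints_iff_convex_sdiff.1 ha).2
  have hmem := hconv.sum_mem (t := Finset.univ) (w := ![x / s, y / s, z / s]) (z := ![p, q, r])
    (by intro i _; fin_cases i <;> simp <;> positivity)
    (by simp [Fin.sum_univ_three]; field_simp; exact hsum)
    (by intro i _; fin_cases i <;> simp [*])
  apply hmem.2
  simp only [Fin.sum_univ_three, Matrix.cons_val, Set.mem_singleton_iff]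
  have : a = s⁻¹ • (x • p + y • q + z • r) := by
    rw [← h, smul_smul, inv_mul_cancel₀ hs.ne', one_smul]
  rw [this]
  simp only [smul_add, smul_smul, div_eq_inv_mul]

/-- A point of `A` in the half-plane cutting off `a`, but outside a half-plane containing the
triangle `abc` of extreme points, lies beyond one of the edges at `a`. -/
theorem beyondEdge_or_beyondEdge {A : Set (ℝ × ℝ)} (hA : Convex ℝ A) {a b c p u ua : ℝ × ℝ}
    {t ta : ℝ} (ha : a ∈ A.extremePoints ℝ) (hb : b ∈ A.extremePoints ℝ)
    (hc : c ∈ A.extremePoints ℝ)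
    (hfa : 0 ≤ slack u t a) (hfb : 0 ≤ slack u t b) (hfc : 0 ≤ slack u t c)
    (haa : 0 ≤ slack ua ta a) (hab : slack ua ta b < 0) (hac : slack ua ta c < 0) (hbc : b ≠ c)
    (hp : p ∈ A) (hfp : slack u t p < 0) (hap : 0 ≤ slack ua ta p)
    (hbary : ∃ x y z : ℝ, x + y + z = 1 ∧ p = x • a + y • b + z • c) :
    BeyondEdge b a c p ∨ BeyondEdge c a b p := by
  obtain ⟨x, y, z, hsum, rfl⟩ := hbary
  have hba : b ≠ a := by rintro rfl; linarith
  have hca : c ≠ a := by rintro rfl; linarith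
  have hpa : x • a + y • b + z • c ≠ a := fun h => by rw [h] at hfp; linarith
  have hpb : x • a + y • b + z • c ≠ b := fun h => by rw [h] at hfp; linarith
  have hpc : x • a + y • b + z • c ≠ c := fun h => by rw [h] at hfp; linarith
  have e1 : ¬ (0 < x ∧ y ≤ 0 ∧ z ≤ 0) := fun ⟨h1, h2, h3⟩ =>
    ne_combination_of_mem_extremePoints hA ha hp hb.1 hc.1 hpa hba hca zero_le_one
      (neg_nonneg.2 h2) (neg_nonneg.2 h3) h1 (by linarith) (by module)
  have e2 : ¬ (0 < y ∧ x ≤ 0 ∧ z ≤ 0) := fun ⟨h1, h2, h3⟩ =>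
    ne_combination_of_mem_extremePoints hA hb hp ha.1 hc.1 hpb hba.symm hbc.symm zero_le_one
      (neg_nonneg.2 h2) (neg_nonneg.2 h3) h1 (by linarith) (by module)
  have e3 : ¬ (0 < z ∧ x ≤ 0 ∧ y ≤ 0) := fun ⟨h1, h2, h3⟩ =>
    ne_combination_of_mem_extremePoints hA hc hp ha.1 hb.1 hpc hca.symm hbc zero_le_one
      (neg_nonneg.2 h2) (neg_nonneg.2 h3) h1 (by linarith) (by module)
  rw [slack_combination _ _ _ _ _ hsum] at hfp hap
  have e4 : ¬ (0 ≤ x ∧ 0 ≤ y ∧ 0 ≤ z) := fun ⟨h1, h2, h3⟩ => by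
    have := mul_nonneg h1 hfa
    have := mul_nonneg h2 hfb
    have := mul_nonneg h3 hfc
    linarith
  have e5 : ¬ (x ≤ 0 ∧ 0 < y ∧ 0 < z) := fun ⟨h1, h2, h3⟩ => by
    have := mul_nonneg (neg_nonneg.2 h1) haa
    have := mul_pos h2 (neg_pos.2 hab)
    have := mul_pos h3 (neg_pos.2 hac)
    linarith
  by_cases hx : 0 < x
  · by_cases hy : 0 < y
    · have hz : z < 0 := by
        by_contra hz
        exact e4 ⟨hx.le, hy.le, not_lt.1 hz⟩
      exact Or.inr ⟨-z, x, y, by linarith, hx, hy, by linarith, by module⟩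
    · have hz : 0 < z := by
        by_contra hz
        exact e1 ⟨hx, not_lt.1 hy, not_lt.1 hz⟩
      have hy' : y < 0 := by
        by_contra hy'
        exact e4 ⟨hx.le, not_lt.1 hy', hz.le⟩
      exact Or.inl ⟨-y, x, z, by linarith, hx, hz, by linarith, by module⟩
  · exfalso
    by_cases hy : 0 < y
    · by_cases hz : 0 < z
      · exact e5 ⟨not_lt.1 hx, hy, hz⟩
      · exact e2 ⟨hy, not_lt.1 hx, not_lt.1 hz⟩
    · exact e3 ⟨by linarith, not_lt.1 hx, not_lt.1 hy⟩

/-- A half-plane containing a triangle of extreme points cannot miss points beyond two different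
edges of the triangle. -/
theorem not_beyondEdge_of_beyondEdge {A : Set (ℝ × ℝ)} (hA : Convex ℝ A) {a b c p q u : ℝ × ℝ}
    {t : ℝ} (hb : b ∈ A) (hc : c ∈ A.extremePoints ℝ) (hbc : b ≠ c)
    (hfa : 0 ≤ slack u t a) (hfc : 0 ≤ slack u t c)
    (hp : p ∈ A) (hq : q ∈ A) (hfp : slack u t p < 0) (hfq : slack u t q < 0)
    (hpe : BeyondEdge a b c p) : ¬ BeyondEdge b a c q := by
  rintro ⟨y₂, y₁, y₃, hy₂, hy₁, hy₃, hy, rfl⟩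
  obtain ⟨x₁, x₂, x₃, hx₁, hx₂, hx₃, hx, rfl⟩ := hpe
  have hpc : x₂ • b + x₃ • c - x₁ • a ≠ c := fun h => by rw [h] at hfp; linarith
  have hqc : y₁ • a + y₃ • c - y₂ • b ≠ c := fun h => by rw [h] at hfq; linarith
  have hp' : x₂ * slack u t b + x₃ * slack u t c + -x₁ * slack u t a < 0 := by
    rw [← slack_combination _ _ _ _ _ (by linarith)]
    convert hfp using 2
    module
  have hq' : y₁ * slack u t a + y₃ * slack u t c + -y₂ * slack u t b < 0 := by
    rw [← slack_combination _ _ _ _ _ (by linarith)]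
    convert hfq using 2
    module
  have hlt : x₂ * y₁ < x₁ * y₂ := by
    have h3 := mul_nonneg hx₃.le hfc
    have h4 := mul_nonneg hy₃.le hfc
    have h1 : x₂ * slack u t b < x₁ * slack u t a := by linarith
    have h2 : y₁ * slack u t a < y₂ * slack u t b := by linarith
    have hfb' : 0 < slack u t b := by
      have := mul_nonneg hy₁.le hfa
      exact pos_of_mul_pos_right (this.trans_lt h2) hy₂.le
    refine lt_of_mul_lt_mul_right ?_ hfb'.le
    have := mul_lt_mul_of_pos_left h1 hy₁
    have := mul_lt_mul_of_pos_left h2 hx₁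
    linarith
  refine ne_combination_of_mem_extremePoints hA hc hp hq hb hpc hqc hbc hy₁.le hx₁.le
    (sub_pos.2 hlt).le (s := y₁ * x₃ + x₁ * y₃) (by positivity) ?_ (by module)
  linear_combination y₁ * (-hx) - x₁ * hy

/-- If a half-plane `H` contains three extreme points, each cut off from the others by a
half-plane, then within `A` one of the three half-planes is contained in `H`. -/
theorem exists_halfPlane_subset {A : Set (ℝ × ℝ)} (hA : Convex ℝ A) {a b c u ua ub uc : ℝ × ℝ}
    {t ta tb tc : ℝ} (ha : a ∈ A.extremePoints ℝ) (hb : b ∈ A.extremePoints ℝ)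
    (hc : c ∈ A.extremePoints ℝ)
    (hfa : 0 ≤ slack u t a) (hfb : 0 ≤ slack u t b) (hfc : 0 ≤ slack u t c)
    (haa : 0 ≤ slack ua ta a) (hab : slack ua ta b < 0) (hac : slack ua ta c < 0)
    (hba : slack ub tb a < 0) (hbb : 0 ≤ slack ub tb b) (hbc : slack ub tb c < 0)
    (hca : slack uc tc a < 0) (hcb : slack uc tc b < 0) (hcc : 0 ≤ slack uc tc c) :
    (∀ p ∈ A, 0 ≤ slack ua ta p → 0 ≤ slack u t p) ∨
    (∀ p ∈ A, 0 ≤ slack ub tb p → 0 ≤ slack u t p) ∨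
    (∀ p ∈ A, 0 ≤ slack uc tc p → 0 ≤ slack u t p) := by
  by_contra! ⟨⟨p, hp, hap, hfp⟩, ⟨q, hq, hbq, hfq⟩, ⟨r, hr, hcr, hfr⟩⟩
  have hab' : a ≠ b := by rintro rfl; linarith
  have hac' : a ≠ c := by rintro rfl; linarith
  have hbc' : b ≠ c := by rintro rfl; linarith
  have hbary := exists_affine_combination haa hab hac hba hbb hbc hca hcb hcc
  have hP := beyondEdge_or_beyondEdge hA ha hb hc hfa hfb hfc haa hab hac hbc' hp hfp hap (hbary p)
  have hQ := beyondEdge_or_beyondEdge hA hb ha hc hfb hfa hfc hbb hba hbc hac' hq hfq hbq <| by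
    obtain ⟨x, y, z, h, h'⟩ := hbary q
    exact ⟨y, x, z, by linarith, by rw [h']; abel⟩
  have hR := beyondEdge_or_beyondEdge hA hc ha hb hfc hfa hfb hcc hca hcb hab' hr hfr hcr <| by
    obtain ⟨x, y, z, h, h'⟩ := hbary r
    exact ⟨z, x, y, by linarith, by rw [h']; abel⟩
  have kab : ∀ {x y}, x ∈ A → y ∈ A → slack u t x < 0 → slack u t y < 0 →
      BeyondEdge a b c x → ¬ BeyondEdge b a c y := fun hx hy hfx hfy =>
    not_beyondEdge_of_beyondEdge hA hb.1 hc hbc' hfa hfc hx hy hfx hfy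
  have kac : ∀ {x y}, x ∈ A → y ∈ A → slack u t x < 0 → slack u t y < 0 →
      BeyondEdge a c b x → ¬ BeyondEdge c a b y := fun hx hy hfx hfy =>
    not_beyondEdge_of_beyondEdge hA hc.1 hb hbc'.symm hfa hfb hx hy hfx hfy
  have kbc : ∀ {x y}, x ∈ A → y ∈ A → slack u t x < 0 → slack u t y < 0 →
      BeyondEdge b c a x → ¬ BeyondEdge c b a y := fun hx hy hfx hfy =>
    not_beyondEdge_of_beyondEdge hA hc.1 ha hac'.symm hfb hfa hx hy hfx hfy
  rcases hP with hP | hP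
  · rcases hQ with hQ | hQ
    · exact kab hq hp hfq hfp hQ hP
    · exact kbc hp hq hfp hfq hP.swap hQ
  · rcases hQ with hQ | hQ
    · exact kac hq hp hfq hfp hQ.swap hP
    · rcases hR with hR | hR
      · exact kac hr hq hfr hfq hR hQ.swap
      · exact kbc hr hq hfr hfq hR hQ

/-- A half-plane meeting a finite set contains an extreme point of its convex hull. -/
theorem exists_extremePoint_slack_nonneg {P : Finset (ℝ × ℝ)} {u p : ℝ × ℝ} {t : ℝ} (hp : p ∈ P)
    (hfp : 0 ≤ slack u t p) :
    ∃ e ∈ (convexHull ℝ (P : Set (ℝ × ℝ))).extremePoints ℝ, 0 ≤ slack u t e := by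
  by_contra! h
  have hcomp := P.finite_toSet.isCompact_convexHull (𝕜 := ℝ)
  have hfin : ((convexHull ℝ (P : Set (ℝ × ℝ))).extremePoints ℝ).Finite :=
    P.finite_toSet.subset extremePoints_convexHull_subset
  have hKM := closure_convexHull_extremePoints hcomp (convex_convexHull ℝ _)
  rw [(hfin.isClosed_convexHull (𝕜 := ℝ)).closure_eq] at hKM
  have hpA := subset_convexHull ℝ (P : Set (ℝ × ℝ)) hp
  rw [← hKM] at hpA
  exact hfp.not_gt (convexHull_min h (convex_neg_slack u t) hpA)

/-- Some set of points meets every half-plane with at least `m` points, and its removal leaves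
at least `m - 2` points in each of those. -/
theorem exists_sparse_hitting_set (P : Finset (ℝ × ℝ)) {m : ℕ} (hm : 0 < m) :
    ∃ N ⊆ P, ∀ u t, m ≤ (halfPlaneTrace P u t).card →
      (∃ p ∈ N, 0 ≤ slack u t p) ∧ m ≤ (halfPlaneTrace (P \ N) u t).card + 2 := by
  classical
  set A := convexHull ℝ (P : Set (ℝ × ℝ)) with hAdef
  have hA : Convex ℝ A := convex_convexHull ℝ _
  let hits : Finset (ℝ × ℝ) → Prop := fun N =>
    ∀ u t, m ≤ (halfPlaneTrace P u t).card → ∃ p ∈ N, 0 ≤ slack u t p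
  let E := P.filter (· ∈ A.extremePoints ℝ)
  have hE : hits E := by
    intro u t h
    obtain ⟨p, hp⟩ := Finset.card_pos.1 (hm.trans_le h)
    rw [mem_halfPlaneTrace] at hp
    obtain ⟨e, he, hfe⟩ := exists_extremePoint_slack_nonneg hp.1 hp.2
    exact ⟨e, Finset.mem_filter.2 ⟨extremePoints_convexHull_subset he, he⟩, hfe⟩
  obtain ⟨N, hNE, hN⟩ := exists_minimal_le_of_wellFoundedLT hits E hE
  have hNP : N ⊆ P := hNE.trans (Finset.filter_subset _ _)
  have hNext : ∀ a ∈ N, a ∈ A.extremePoints ℝ := fun a ha => (Finset.mem_filter.1 (hNE ha)).2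
  have hpriv : ∀ a ∈ N, ∃ u t, m ≤ (halfPlaneTrace P u t).card ∧ 0 ≤ slack u t a ∧
      ∀ b ∈ N, b ≠ a → slack u t b < 0 := by
    intro a ha
    have := hN.not_prop_of_lt (Finset.erase_ssubset ha)
    simp only [hits, not_forall, not_exists, not_and, not_le, Finset.mem_erase] at this
    obtain ⟨u, t, hcard, h⟩ := this
    obtain ⟨p, hp, hfp⟩ := hN.prop u t hcard
    refine ⟨u, t, hcard, ?_, fun b hb hba => h b ⟨hba, hb⟩⟩
    by_cases hpa : p = a
    · rwa [← hpa]
    · exact absurd (h p ⟨hpa, hp⟩) hfp.not_gt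
  refine ⟨N, hNP, fun u t hcard => ⟨hN.prop u t hcard, ?_⟩⟩
  have hsplit : ∀ v s, halfPlaneTrace P v s ⊆ halfPlaneTrace (P \ N) v s ∪ halfPlaneTrace N v s := by
    intro v s p
    simp only [Finset.mem_union, mem_halfPlaneTrace, Finset.mem_sdiff]
    tauto
  by_cases hle : (halfPlaneTrace N u t).card ≤ 2
  · have := (Finset.card_le_card (hsplit u t)).trans (Finset.card_union_le _ _)
    omega
  -- some private half-plane is contained in the given one
  have hsub : ∃ a ∈ N, ∃ v s, m ≤ (halfPlaneTrace P v s).card ∧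
      (∀ b ∈ N, b ≠ a → slack v s b < 0) ∧ ∀ p ∈ A, 0 ≤ slack v s p → 0 ≤ slack u t p := by
    obtain ⟨a, b, c, ha, hb, hc, hab, hac, hbc⟩ := Finset.two_lt_card_iff.1 (not_le.1 hle)
    rw [mem_halfPlaneTrace] at ha hb hc
    obtain ⟨ua, ta, ma, haa, hoa⟩ := hpriv a ha.1
    obtain ⟨ub, tb, mb, hbb, hob⟩ := hpriv b hb.1
    obtain ⟨uc, tc, mc, hcc, hoc⟩ := hpriv c hc.1
    rcases exists_halfPlane_subset hA (hNext a ha.1) (hNext b hb.1) (hNext c hc.1) ha.2 hb.2 hc.2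
      haa (hoa b hb.1 hab.symm) (hoa c hc.1 hac.symm) (hob a ha.1 hab) hbb (hob c hc.1 hbc.symm)
      (hoc a ha.1 hac) (hoc b hb.1 hbc) hcc with h | h | h
    · exact ⟨a, ha.1, ua, ta, ma, hoa, h⟩
    · exact ⟨b, hb.1, ub, tb, mb, hob, h⟩
    · exact ⟨c, hc.1, uc, tc, mc, hoc, h⟩
  obtain ⟨a, -, v, s, hvs, ho, hvu⟩ := hsub
  have h1 : halfPlaneTrace N v s ⊆ {a} := by
    intro p hp
    rw [mem_halfPlaneTrace] at hp
    by_contra hpa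
    exact hp.2.not_gt (ho p hp.1 (by simpa using hpa))
  have h2 : halfPlaneTrace (P \ N) v s ⊆ halfPlaneTrace (P \ N) u t := by
    intro p hp
    rw [mem_halfPlaneTrace] at hp ⊢
    exact ⟨hp.1, hvu p (subset_convexHull ℝ _ (Finset.mem_sdiff.1 hp.1).1) hp.2⟩
  have := (Finset.card_le_card (hsplit v s)).trans (Finset.card_union_le _ _)
  have := Finset.card_le_card h1
  have := Finset.card_le_card h2
  simp only [Finset.card_singleton] at *
  omega

theorem exists_polychromatic_coloring (k : ℕ) (P : Finset (ℝ × ℝ)) :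
    ∃ χ : ℝ × ℝ → Fin (k + 1), ∀ u t, 2 * k + 1 ≤ (halfPlaneTrace P u t).card →
      ∀ col, ∃ p ∈ P, 0 ≤ slack u t p ∧ χ p = col := by
  classical
  induction k generalizing P with
  | zero =>
    refine ⟨fun _ => 0, fun u t h col => ?_⟩
    obtain ⟨p, hp⟩ := Finset.card_pos.1 (show 0 < (halfPlaneTrace P u t).card by omega)
    rw [mem_halfPlaneTrace] at hp
    exact ⟨p, hp.1, hp.2, (Fin.fin_one_eq_zero col).symm⟩
  | succ k ih =>
    obtain ⟨N, hNP, hN⟩ := exists_sparse_hitting_set P (m := 2 * (k + 1) + 1) (by omega)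
    obtain ⟨χ, hχ⟩ := ih (P \ N)
    refine ⟨fun p => if p ∈ N then Fin.last _ else (χ p).castSucc, fun u t h col => ?_⟩
    obtain ⟨⟨q, hq, hfq⟩, hcard⟩ := hN u t h
    induction col using Fin.lastCases with
    | last => exact ⟨q, hNP hq, hfq, if_pos hq⟩
    | cast col =>
      obtain ⟨p, hp, hfp, hpc⟩ := hχ u t (by omega) col
      rw [Finset.mem_sdiff] at hp
      exact ⟨p, hp.1, hfp, by simp [hp.2, hpc]⟩

/-- Points on the parabola `y = x ^ 2` with integer abscissae can be cut off one at a time. -/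
theorem exists_points_without_polychromatic_coloring (k : ℕ) :
    ∃ P : Finset (ℝ × ℝ), ∀ χ : ℝ × ℝ → Fin (k + 1), ∃ u : ℝ × ℝ, u ≠ 0 ∧ ∃ t : ℝ,
      (halfPlaneTrace P u t).card = 2 * k ∧
        ∃ col, ∀ p ∈ P, 0 ≤ slack u t p → χ p ≠ col := by
  classical
  let g : ℕ → ℝ × ℝ := fun i => (i, (i : ℝ) ^ 2)
  have hg : Function.Injective g := fun i j h => by simpa [g] using congrArg Prod.fst h
  let P := (Finset.range (2 * k + 1)).image g
  have hP : P.card = 2 * k + 1 := by simp [P, Finset.card_image_of_injective _ hg]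
  refine ⟨P, fun χ => ?_⟩
  obtain ⟨col, -, hcol⟩ := Finset.exists_card_fiber_lt_of_card_lt_mul (s := P) (t := Finset.univ)
    (f := χ) (n := 2) (by simp [hP]; omega)
  have hq : ∃ q ∈ P, ∀ p ∈ P, p ≠ q → χ p ≠ col := by
    rcases Finset.eq_empty_or_nonempty (P.filter (χ · = col)) with h | ⟨q, hq⟩
    · obtain ⟨q, hq⟩ := Finset.card_pos.1 (show 0 < P.card by omega)
      exact ⟨q, hq, fun p hp _ => Finset.filter_eq_empty_iff.1 h hp⟩
    · refine ⟨q, (Finset.mem_filter.1 hq).1, fun p hp hpq hpc => hpq ?_⟩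
      exact Finset.card_le_one.1 (Nat.lt_succ_iff.1 hcol) p (Finset.mem_filter.2 ⟨hp, hpc⟩) q hq
  obtain ⟨q, hq, hqcol⟩ := hq
  obtain ⟨i, -, rfl⟩ := Finset.mem_image.1 hq
  have hslack : ∀ p ∈ P, (0 ≤ slack (-2 * (i : ℝ), 1) (1 - (i : ℝ) ^ 2) p ↔ p ≠ g i) := by
    intro p hp
    obtain ⟨j, -, rfl⟩ := Finset.mem_image.1 hp
    have h : slack (-2 * (i : ℝ), 1) (1 - (i : ℝ) ^ 2) (g j) = ((j : ℝ) - i) ^ 2 - 1 := by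
      simp only [slack, g]
      ring
    rw [h, hg.ne_iff]
    constructor
    · rintro h rfl
      norm_num at h
    · intro hji
      have : (1 : ℤ) ≤ ((j : ℤ) - i) ^ 2 :=
        Int.add_one_le_iff.2 (sq_pos_of_ne_zero (sub_ne_zero.2 (by exact_mod_cast hji)))
      have : (1 : ℝ) ≤ ((j : ℝ) - i) ^ 2 := by exact_mod_cast this
      linarith
  refine ⟨(-2 * (i : ℝ), 1), fun h => by simpa using congrArg Prod.snd h, 1 - (i : ℝ) ^ 2, ?_,
    col, fun p hp h => hqcol p hp ((hslack p hp).1 h)⟩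
  have : halfPlaneTrace P (-2 * (i : ℝ), 1) (1 - (i : ℝ) ^ 2) = P.erase (g i) := by
    ext p
    rw [mem_halfPlaneTrace, Finset.mem_erase, and_comm]
    exact and_congr_left fun hp => hslack p hp
  rw [this, Finset.card_erase_of_mem hq, hP, Nat.add_sub_cancel]

theorem ncard_eq_card_halfPlaneTrace (P : Finset (ℝ × ℝ)) (u : ℝ × ℝ) (t : ℝ) :
    {p : ℝ × ℝ | p ∈ P ∧ t ≤ u.1 * p.1 + u.2 * p.2}.ncard = (halfPlaneTrace P u t).card := by
  rw [← Set.ncard_coe_finset]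
  congr 1
  ext p
  simp [mem_halfPlaneTrace, slack]


/-- for half-planes m_k = 2k-1: any finite planar point set can be
k-colored so that every closed half-plane with at least 2k-1 points contains all k
colors, and this is tight: some point set admits, for every k-coloring, a closed
half-plane with exactly 2k-2 points missing some color. -/
theorem stmt13 (k : ℕ) (hk : 0 < k) :
    (∀ P : Finset (ℝ × ℝ), ∃ χ : ℝ × ℝ → Fin k,
      ∀ u : ℝ × ℝ, u ≠ 0 → ∀ t : ℝ,
        2 * k - 1 ≤ {p : ℝ × ℝ | p ∈ P ∧ t ≤ u.1 * p.1 + u.2 * p.2}.ncard →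
        ∀ col : Fin k, ∃ p ∈ P, t ≤ u.1 * p.1 + u.2 * p.2 ∧ χ p = col) ∧
    (∃ P : Finset (ℝ × ℝ), ∀ χ : ℝ × ℝ → Fin k,
      ∃ u : ℝ × ℝ, u ≠ 0 ∧ ∃ t : ℝ,
        {p : ℝ × ℝ | p ∈ P ∧ t ≤ u.1 * p.1 + u.2 * p.2}.ncard = 2 * k - 2 ∧
        ∃ col : Fin k, ∀ p ∈ P, t ≤ u.1 * p.1 + u.2 * p.2 → χ p ≠ col) := by
  obtain ⟨k, rfl⟩ := Nat.exists_eq_add_of_lt hk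
  rw [zero_add]
  simp only [ncard_eq_card_halfPlaneTrace]
  constructor
  · intro P
    obtain ⟨χ, hχ⟩ := exists_polychromatic_coloring k P
    refine ⟨χ, fun u _ t h col => ?_⟩
    obtain ⟨p, hp, hfp, hpc⟩ := hχ u t (by omega) col
    exact ⟨p, hp, sub_nonneg.1 hfp, hpc⟩
  · obtain ⟨P, hP⟩ := exists_points_without_polychromatic_coloring k
    refine ⟨P, fun χ => ?_⟩
    obtain ⟨u, hu, t, hcard, col, hcol⟩ := hP χ
    exact ⟨u, hu, t, by omega, col, fun p hp h => hcol p hp (sub_nonneg.2 h)⟩
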